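/- arXiv:1706.03342 — 2 statements merged into one kernel-verified Lean document; each statement's English description precedes it below -/
import Mathlib

section
/- Let C > 0 and let h = (h₁, h₂) be uniformly distributed on the sphere {h ∈ ℂ² : |h₁|² + |h₂|² = 2^C − 1}. Define C_sym = min{ 2·log₂(1 + |h₁|²), 2·log₂(1 + |h₂|²), C }. Then P(C_sym = C) = 1 − 2·(2^{C/2} − 1)/(2^C − 1). -/
open MeasureTheory

noncomputable instance {n : ℕ} : MeasurableSpace (EuclideanSpace ℂ (Fin n)) :=
  borel _

instance borelE {n : ℕ} : BorelSpace (EuclideanSpace ℂ (Fin n)) := ⟨rfl⟩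

abbrev E2 := EuclideanSpace ℂ (Fin 2)

open Real Set Filter Topology

lemma tail_real {a : ℝ} (ha : 0 ≤ a) :
    ∫⁻ r in Ioi a, ENNReal.ofReal (r * exp (-r ^ 2)) = ENNReal.ofReal (exp (-a ^ 2) / 2) := by
  have hd : ∀ x : ℝ, HasDerivAt (fun r : ℝ => -(exp (-r ^ 2) / 2)) (x * exp (-x ^ 2)) x := by
    intro x
    have h0 : HasDerivAt (fun r : ℝ => -r ^ 2) (-(2 * x)) x := by
      simpa using (hasDerivAt_pow 2 x).fun_neg
    have h := ((h0.exp).div_const 2).fun_neg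
    have e : -(exp (-x ^ 2) * -(2 * x) / 2) = x * exp (-x ^ 2) := by ring
    rwa [e] at h
  have hlim : Tendsto (fun r : ℝ => -(exp (-r ^ 2) / 2)) atTop (𝓝 0) := by
    have h1 : Tendsto (fun r : ℝ => exp (-r ^ 2)) atTop (𝓝 0) :=
      tendsto_exp_neg_atTop_nhds_zero.comp (tendsto_pow_atTop two_ne_zero)
    simpa using (h1.div_const 2).neg
  have hnn : ∀ x ∈ Ioi a, 0 ≤ x * exp (-x ^ 2) := fun x hx =>
    mul_nonneg (ha.trans (le_of_lt hx)) (exp_pos _).le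
  have hc := (hd a).continuousAt.continuousWithinAt (s := Ici a)
  have hint := integrableOn_Ioi_deriv_of_nonneg hc (fun x _ => hd x) hnn hlim
  rw [← ofReal_integral_eq_lintegral_ofReal hint
    ((ae_restrict_iff' measurableSet_Ioi).2 (Eventually.of_forall hnn)),
    integral_Ioi_of_hasDerivAt_of_tendsto hc (fun x _ => hd x) hint hlim]
  simp

lemma tail_complex {s : ℝ} (hs : 0 ≤ s) :
    ∫⁻ w : ℂ, {w : ℂ | s < ‖w‖ ^ 2}.indicator (fun w => ENNReal.ofReal (exp (-‖w‖ ^ 2))) w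
      = ENNReal.ofReal (π * exp (-s)) := by
  rw [← Complex.lintegral_comp_polarCoord_symm, polarCoord_target]
  have hsub : Ioi (√s) ×ˢ Ioo (-π) π ⊆ Ioi (0:ℝ) ×ˢ Ioo (-π) π :=
    prod_mono (Ioi_subset_Ioi (sqrt_nonneg s)) subset_rfl
  have : ∀ p ∈ Ioi (0:ℝ) ×ˢ Ioo (-π) π, ENNReal.ofReal p.1 • {w : ℂ | s < ‖w‖ ^ 2}.indicator
      (fun w => ENNReal.ofReal (exp (-‖w‖ ^ 2))) (Complex.polarCoord.symm p)
      = (Ioi (√s) ×ˢ Ioo (-π) π).indicator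
        (fun p => ENNReal.ofReal (p.1 * exp (-p.1 ^ 2)) * 1) p := by
    rintro ⟨r, θ⟩ ⟨hr, hθ⟩
    have hr' : 0 < r := hr
    simp only [indicator, mem_ofPred_eq, Complex.norm_polarCoord_symm, sq_abs, mem_prod, hθ,
      and_true, mem_Ioi, Real.sqrt_lt' hr', smul_eq_mul, mul_one]
    split_ifs
    · rw [ENNReal.ofReal_mul hr'.le]
    · simp
  rw [setLIntegral_congr_fun (measurableSet_Ioi.prod measurableSet_Ioo) this,
    setLIntegral_indicator (measurableSet_Ioi.prod measurableSet_Ioo),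
    inter_eq_left.2 hsub, Measure.volume_eq_prod, ← Measure.prod_restrict,
    lintegral_prod_mul (f := fun r : ℝ => ENNReal.ofReal (r * exp (-r ^ 2)))
      (g := fun _ : ℝ => (1 : ENNReal)) (by fun_prop) (by fun_prop), tail_real (sqrt_nonneg s)]
  simp only [sq_sqrt hs, lintegral_const, one_mul, Measure.restrict_apply MeasurableSet.univ,
    univ_inter, Real.volume_Ioo]
  rw [← ENNReal.ofReal_mul (by positivity)]
  congr 1; ring

lemma gauss_complex {b : ℝ} (hb : 0 < b) :
    ∫⁻ z : ℂ, ENNReal.ofReal (exp (-b * ‖z‖ ^ 2)) = ENNReal.ofReal (π / b) := by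
  have h := GaussianFourier.integral_rexp_neg_mul_sq_norm (V := ℂ) hb
  have h2 : (Module.finrank ℝ ℂ / 2 : ℝ) = 1 := by simp
  rw [h2, rpow_one] at h
  have hint : Integrable (fun z : ℂ => exp (-b * ‖z‖ ^ 2)) := by
    by_contra hn
    rw [integral_undef hn] at h
    have : 0 < π / b := by positivity
    linarith
  rw [← h, ofReal_integral_eq_lintegral_ofReal hint
    (Eventually.of_forall fun _ => (exp_pos _).le)]

/-- Invariance under unitaries. -/
def UInv (μ : Measure E2) : Prop := ∀ e : E2 ≃ₗᵢ[ℂ] E2, Measure.map e μ = μ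

lemma meas_A (i : Fin 2) (t : ℝ) : MeasurableSet {h : E2 | ‖h i‖ ^ 2 < t * ‖h‖ ^ 2} := by
  apply IsOpen.measurableSet
  exact isOpen_lt (by fun_prop) (by fun_prop)

lemma inv_dir {μ : Measure E2} (hμ : UInv μ) (i : Fin 2) (t : ℝ) {v : E2} (hv : v ≠ 0) :
    μ {h : E2 | ‖inner ℂ v h‖ ^ 2 < t * (‖v‖ ^ 2 * ‖h‖ ^ 2)}
      = μ {h : E2 | ‖h i‖ ^ 2 < t * ‖h‖ ^ 2} := by
  have hvn : 0 < ‖v‖ := norm_pos_iff.2 hv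
  have ho : Orthonormal ℂ (({i} : Set (Fin 2)).domRestrict
      (fun _ : Fin 2 => ((‖v‖ : ℂ)⁻¹ • v : E2))) := by
    constructor
    · intro j
      simp [norm_smul, hvn.ne']
    · intro j k hjk
      exact absurd (Subsingleton.elim j k) hjk
  obtain ⟨b, hb⟩ := ho.exists_orthonormalBasis_extension_of_card_eq (by simp)
  have hbi := hb i rfl
  conv_rhs => rw [← hμ b.repr]
  rw [Measure.map_apply b.repr.continuous.measurable (meas_A i t)]
  congr 1
  ext h
  simp only [mem_ofPred_eq, mem_preimage, b.repr_apply_apply, hbi, inner_smul_left,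
    LinearIsometryEquiv.norm_map, norm_mul, mul_pow]
  have : ‖(starRingEnd ℂ) (‖v‖ : ℂ)⁻¹‖ = ‖v‖⁻¹ := by simp
  rw [this, inv_pow, inv_mul_lt_iff₀ (by positivity)]
  constructor <;> intro h' <;> linarith

lemma uinv_unique {μ ρ : Measure E2} [SFinite μ] [SFinite ρ] (hμ : UInv μ) (hρ : UInv ρ)
    (hμ0 : ∀ᵐ h ∂μ, h ≠ 0) (hρ0 : ∀ᵐ h ∂ρ, h ≠ 0) (i j : Fin 2) (t : ℝ) :
    μ {h : E2 | ‖h i‖ ^ 2 < t * ‖h‖ ^ 2} * ρ univ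
      = ρ {h : E2 | ‖h j‖ ^ 2 < t * ‖h‖ ^ 2} * μ univ := by
  let T : Set (E2 × E2) := {p | ‖inner ℂ p.1 p.2‖ ^ 2 < t * (‖p.1‖ ^ 2 * ‖p.2‖ ^ 2)}
  have hT : MeasurableSet T := by
    apply IsOpen.measurableSet
    exact isOpen_lt (by fun_prop) (by fun_prop)
  have h1 : (ρ.prod μ) T = μ {h : E2 | ‖h i‖ ^ 2 < t * ‖h‖ ^ 2} * ρ univ := by
    rw [Measure.prod_apply hT, ← lintegral_const]
    apply lintegral_congr_ae
    filter_upwards [hρ0] with v hv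
    exact inv_dir hμ i t hv
  have h2 : (ρ.prod μ) T = ρ {h : E2 | ‖h j‖ ^ 2 < t * ‖h‖ ^ 2} * μ univ := by
    rw [Measure.prod_apply_symm hT, ← lintegral_const]
    apply lintegral_congr_ae
    filter_upwards [hμ0] with v hv
    rw [← inv_dir hρ j t hv]
    congr 1
    ext h
    simp only [T, mem_preimage, mem_ofPred_eq, norm_inner_symm h v, mul_comm (‖h‖ ^ 2)]
  rw [← h1, h2]

/-- Lebesgue measure. -/
noncomputable def leb : Measure E2 :=
  Measure.map (PiLp.continuousLinearEquiv 2 ℝ (fun _ : Fin 2 => ℂ)).symm volume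

instance : leb.IsAddHaarMeasure :=
  (PiLp.continuousLinearEquiv 2 ℝ (fun _ : Fin 2 => ℂ)).symm.isAddHaarMeasure_map volume

lemma inv_leb : UInv leb := by
  intro e
  have : (Measure.map e leb).IsAddHaarMeasure :=
    e.toContinuousLinearEquiv.isAddHaarMeasure_map leb
  have h := Measure.isAddLeftInvariant_eq_smul (Measure.map e leb) leb
  have hb := congrArg (fun m => m (Metric.ball (0 : E2) 1)) h
  simp only [Measure.smul_apply] at hb
  rw [Measure.map_apply e.continuous.measurable measurableSet_ball] at hb
  have hpre : e ⁻¹' (Metric.ball (0 : E2) 1) = Metric.ball 0 1 := by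
    ext x; simp
  rw [hpre] at hb
  have hpos : leb (Metric.ball (0 : E2) 1) ≠ 0 := (Metric.measure_ball_pos leb 0 one_pos).ne'
  have hfin : leb (Metric.ball (0 : E2) 1) ≠ ⊤ := measure_ball_lt_top.ne
  rw [ENNReal.smul_def, smul_eq_mul] at hb
  have hc : ((Measure.map e leb).addHaarScalarFactor leb : ENNReal) = 1 := by
    refine (ENNReal.mul_left_inj hpos hfin).1 ?_
    rw [← hb, one_mul]
  rw [h]
  have : (Measure.map e leb).addHaarScalarFactor leb = 1 := by exact_mod_cast hc
  rw [this, one_smul]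

/-- Gaussian measure. -/
noncomputable def gau : Measure E2 :=
  leb.withDensity (fun h => ENNReal.ofReal (exp (-‖h‖ ^ 2)))

instance : SFinite gau := by unfold gau; infer_instance

lemma inv_gau : UInv gau := by
  intro e
  ext s hs
  rw [Measure.map_apply e.continuous.measurable hs, gau, 
    withDensity_apply _ (e.continuous.measurable hs), withDensity_apply _ hs]
  conv_rhs => rw [← inv_leb e]
  rw [setLIntegral_map hs (by fun_prop) e.continuous.measurable]
  simp

lemma gau_ne : ∀ᵐ h ∂gau, h ≠ 0 := by
  have : ∀ᵐ h ∂leb, h ≠ 0 := by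
    simp [ae_iff]
  exact (withDensity_absolutelyContinuous _ _).ae_le this

lemma gau_apply {s : Set E2} (hs : MeasurableSet s) :
    gau s = ∫⁻ z : ℂ, ∫⁻ w : ℂ, s.indicator 
      (fun h => ENNReal.ofReal (exp (-‖h‖ ^ 2))) (!₂[z, w]) := by
  have hm : Measurable (s.indicator (fun h : E2 => ENNReal.ofReal (exp (-‖h‖ ^ 2)))) :=
    Measurable.indicator (by fun_prop) hs
  rw [gau, withDensity_apply _ hs, ← lintegral_indicator hs, leb,
    lintegral_map hm (ContinuousLinearEquiv.continuous _).measurable,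
    ← (volume_preserving_finTwoArrow ℂ).symm.lintegral_comp
      (f := fun a => s.indicator (fun h : E2 => ENNReal.ofReal (exp (-‖h‖ ^ 2)))
        ((PiLp.continuousLinearEquiv 2 ℝ fun _ : Fin 2 => ℂ).symm a))
      (hm.comp (ContinuousLinearEquiv.continuous _).measurable), Measure.volume_eq_prod,
    lintegral_prod]
  · rfl
  · apply Measurable.aemeasurable
    exact (hm.comp (ContinuousLinearEquiv.continuous _).measurable).comp (MeasurableEquiv.measurable _)

lemma norm_pair (z w : ℂ) : ‖(!₂[z, w] : E2)‖ ^ 2 = ‖z‖ ^ 2 + ‖w‖ ^ 2 := by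
  simp [EuclideanSpace.norm_sq_eq]

lemma gau_univ : gau univ = ENNReal.ofReal (π * π) := by
  rw [gau_apply MeasurableSet.univ]
  have h1 := gauss_complex one_pos
  simp only [neg_one_mul, div_one] at h1
  simp only [indicator_univ, norm_pair, neg_add, exp_add, ENNReal.ofReal_mul (exp_pos _).le]
  simp_rw [lintegral_const_mul' _ _ ENNReal.ofReal_ne_top, h1]
  rw [lintegral_mul_const' _ _ ENNReal.ofReal_ne_top, h1, ENNReal.ofReal_mul pi_pos.le]

lemma gau_A {t : ℝ} (h0 : 0 < t) (h1 : t < 1) :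
    gau {h : E2 | ‖h 0‖ ^ 2 < t * ‖h‖ ^ 2} = ENNReal.ofReal (t * (π * π)) := by
  rw [gau_apply (meas_A 0 t)]
  have key : ∀ z w : ℂ, {h : E2 | ‖h 0‖ ^ 2 < t * ‖h‖ ^ 2}.indicator 
      (fun h => ENNReal.ofReal (exp (-‖h‖ ^ 2))) (!₂[z, w]) = 
      ENNReal.ofReal (exp (-‖z‖ ^ 2)) * {w : ℂ | (1 - t) / t * ‖z‖ ^ 2 < ‖w‖ ^ 2}.indicator
        (fun w => ENNReal.ofReal (exp (-‖w‖ ^ 2))) w := by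
    intro z w
    have hiff : (‖z‖ ^ 2 < t * (‖z‖ ^ 2 + ‖w‖ ^ 2)) ↔ (1 - t) / t * ‖z‖ ^ 2 < ‖w‖ ^ 2 := by
      rw [div_mul_eq_mul_div, div_lt_iff₀ h0]
      constructor <;> intro h <;> linarith
    simp only [indicator, mem_ofPred_eq, norm_pair]
    simp only [Matrix.cons_val_zero, hiff]
    split_ifs
    · rw [neg_add, exp_add, ENNReal.ofReal_mul (exp_pos _).le]
    · simp
  have hc : 0 ≤ (1 - t) / t := div_nonneg (by linarith) h0.le
  simp_rw [key, lintegral_const_mul' _ _ ENNReal.ofReal_ne_top]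
  have : ∀ z : ℂ, ENNReal.ofReal (exp (-‖z‖ ^ 2)) * 
      ∫⁻ w : ℂ, {w : ℂ | (1 - t) / t * ‖z‖ ^ 2 < ‖w‖ ^ 2}.indicator
        (fun w => ENNReal.ofReal (exp (-‖w‖ ^ 2))) w = 
      ENNReal.ofReal π * ENNReal.ofReal (exp (-t⁻¹ * ‖z‖ ^ 2)) := by
    intro z
    rw [tail_complex (by positivity), ← ENNReal.ofReal_mul (exp_pos _).le, 
      ← ENNReal.ofReal_mul pi_pos.le, mul_left_comm, ← exp_add]
    congr 3
    field_simp; ring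
  simp_rw [this]
  rw [lintegral_const_mul' _ _ ENNReal.ofReal_ne_top, gauss_complex (by positivity), 
    ← ENNReal.ofReal_mul pi_pos.le]
  congr 1
  field_simp

lemma inv_prob {μ : Measure E2} [IsProbabilityMeasure μ] (hμ : UInv μ)
    (hμ0 : ∀ᵐ h ∂μ, h ≠ 0) (i : Fin 2) {t : ℝ} (h0 : 0 < t) (h1 : t < 1) :
    μ {h : E2 | ‖h i‖ ^ 2 < t * ‖h‖ ^ 2} = ENNReal.ofReal t := by
  have h := uinv_unique hμ inv_gau hμ0 gau_ne i 0 t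
  rw [gau_univ, gau_A h0 h1, measure_univ, mul_one, ENNReal.ofReal_mul h0.le] at h
  refine (ENNReal.mul_left_inj ?_ ENNReal.ofReal_ne_top).1 h
  simp [pi_pos]

/-- for `h = (h₁,h₂)` uniformly distributed on the complex sphere
`{h : |h₁|² + |h₂|² = 2^C − 1}` (i.e. `μ` is a probability measure carried by the
sphere and invariant under every unitary transformation), the symmetric-rate
capacity `C_sym = min{2·log₂(1+|h₁|²), 2·log₂(1+|h₂|²), C}` satisfies
`P(C_sym = C) = 1 − 2·(2^{C/2} − 1)/(2^C − 1)`. -/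
theorem two_user_MAC_sym_capacity_eq_sum_capacity (C : ℝ) (hC : 0 < C)
    (μ : Measure (EuclideanSpace ℂ (Fin 2))) [IsProbabilityMeasure μ]
    (hsphere : μ {h : EuclideanSpace ℂ (Fin 2) |
        ‖h 0‖ ^ 2 + ‖h 1‖ ^ 2 = (2 : ℝ) ^ C - 1} = 1)
    (hinv : ∀ e : EuclideanSpace ℂ (Fin 2) ≃ₗᵢ[ℂ] EuclideanSpace ℂ (Fin 2),
      Measure.map e μ = μ) :
    (μ {h : EuclideanSpace ℂ (Fin 2) |
        min (min (2 * Real.logb 2 (1 + ‖h 0‖ ^ 2))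
            (2 * Real.logb 2 (1 + ‖h 1‖ ^ 2))) C = C}).toReal =
      1 - 2 * ((2 : ℝ) ^ (C / 2) - 1) / ((2 : ℝ) ^ C - 1) := by
  have hq1 : 1 < (2 : ℝ) ^ (C / 2) := Real.one_lt_rpow one_lt_two (by linarith)
  have hq2 : (2 : ℝ) ^ C = (2 : ℝ) ^ (C / 2) * (2 : ℝ) ^ (C / 2) := by
    rw [← Real.rpow_add two_pos]; congr 1; ring
  have hlog : ∀ x : ℝ, 0 ≤ x → (C ≤ 2 * Real.logb 2 (1 + x) ↔ (2 : ℝ) ^ (C / 2) - 1 ≤ x) := by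
    intro x hx
    have := Real.le_logb_iff_rpow_le (b := 2) (x := C / 2) (y := 1 + x) one_lt_two (by linarith)
    rw [sub_le_iff_le_add', ← this]
    constructor <;> intro h <;> linarith
  set q := (2 : ℝ) ^ (C / 2) with hq
  have hR : 0 < (2 : ℝ) ^ C - 1 := by rw [hq2]; nlinarith
  set R := (2 : ℝ) ^ C - 1 with hRdef
  have hRa : 2 * (q - 1) < R := by rw [hRdef, hq2]; nlinarith
  have hnorm : ∀ h : E2, ‖h‖ ^ 2 = ‖h 0‖ ^ 2 + ‖h 1‖ ^ 2 := by
    intro h; simp [EuclideanSpace.norm_sq_eq]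
  have hS : ∀ᵐ h ∂μ, ‖h‖ ^ 2 = R := by
    rw [← prob_compl_eq_zero_iff] at hsphere
    · rw [ae_iff]
      rw [← hsphere]
      congr 1
      ext h
      simp [hnorm]
    · apply IsClosed.measurableSet
      exact isClosed_eq (by fun_prop) (by fun_prop)
  have hne : ∀ᵐ h ∂μ, h ≠ 0 := by
    filter_upwards [hS] with h hh h0
    rw [h0] at hh
    simp at hh
    linarith
  have h0 : 0 < (q - 1) / R := div_pos (by linarith) hR
  have h1 : (q - 1) / R < 1 := by rw [div_lt_one hR]; linarith
  have hP := fun i => inv_prob (μ := μ) hinv hne i h0 h1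
  set t := (q - 1) / R with ht
  have htR : t * R = q - 1 := by rw [ht]; field_simp
  have hset : {h : E2 | min (min (2 * Real.logb 2 (1 + ‖h 0‖ ^ 2))
            (2 * Real.logb 2 (1 + ‖h 1‖ ^ 2))) C = C} =ᵐ[μ]
      (({h : E2 | ‖h 0‖ ^ 2 < t * ‖h‖ ^ 2} ∪ {h : E2 | ‖h 1‖ ^ 2 < t * ‖h‖ ^ 2})ᶜ : Set E2) := by
    rw [eventuallyEq_set]
    filter_upwards [hS] with h hh
    simp only [mem_ofPred_eq, mem_compl_iff, mem_union, not_or, not_lt, hh, htR, min_eq_right_iff,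
      le_min_iff]
    rw [hlog _ (sq_nonneg _), hlog _ (sq_nonneg _)]
  have hdisj : AEDisjoint μ {h : E2 | ‖h 0‖ ^ 2 < t * ‖h‖ ^ 2}
      {h : E2 | ‖h 1‖ ^ 2 < t * ‖h‖ ^ 2} := by
    have : ∀ᵐ h ∂μ, ¬ (h ∈ {h : E2 | ‖h 0‖ ^ 2 < t * ‖h‖ ^ 2} ∩
      {h : E2 | ‖h 1‖ ^ 2 < t * ‖h‖ ^ 2}) := by
      filter_upwards [hS] with h hh
      rintro ⟨ha, hb⟩
      simp only [mem_ofPred_eq, hh, htR] at ha hb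
      have := hnorm h
      linarith
    rw [ae_iff] at this
    rw [AEDisjoint, ← this]
    congr 1
    ext h
    simp
  rw [measure_congr hset, prob_compl_eq_one_sub ((meas_A 0 t).union (meas_A 1 t)),
    measure_union₀ (meas_A 1 t).nullMeasurableSet hdisj, hP 0, hP 1,
    ← ENNReal.ofReal_add h0.le h0.le, ← ENNReal.ofReal_one, ← ENNReal.ofReal_sub _ (by linarith),
    ENNReal.toReal_ofReal, ht]
  · ring
  · have : t + t < 1 := by
      rw [ht, ← add_div, div_lt_one hR]; linarith
    linarith
end

section
/- Let μ be the Haar probability measure on the unitary group U(2) of 2×2 complex unitary matrices. Let C > 0, let ρ₁ ≥ ρ₂ ≥ 0 satisfy (1+ρ₁)(1+ρ₂) = 2^C with ρ₁ > ρ₂, and let R satisfy 2·log₂(1+ρ₂) ≤ R ≤ C. Define R_ML(U) = min{ 2·log₂(1 + ρ₁|U₁₁|² + ρ₂|U₂₁|²), 2·log₂(1 + ρ₁|U₁₂|² + ρ₂|U₂₂|²), C }. Then μ{U : R_ML(U) < R} = 2·(2^{R/2} − 1 − ρ₂)/(2^C/(1+ρ₂) − 1 − ρ₂). -/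
open MeasureTheory Matrix

noncomputable instance {n : ℕ} : MeasurableSpace (Matrix.unitaryGroup (Fin n) ℂ) :=
  borel _

lemma radial_tail (b a : ℝ) (hb : 0 < b) (ha : 0 ≤ a) (f : ℝ → ℝ) (hf0 : ∀ y, 0 ≤ f y)
    (hf : ∀ y, 0 < y → f y = (Set.Ioi a).indicator (fun y => Real.exp (-b * y ^ 2)) y) :
    ∫⁻ z : ℂ, ENNReal.ofReal (f ‖z‖) = ENNReal.ofReal (Real.pi / b * Real.exp (-b * a ^ 2)) := by
  have hint : Integrable (fun y : ℝ => y * Real.exp (-b * y ^ 2)) := integrable_mul_exp_neg_mul_sq hb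
  have hfun : ∀ y ∈ Set.Ioi (0 : ℝ), y ^ (Module.finrank ℝ ℂ - 1) • f y
      = (Set.Ioi a).indicator (fun y => y * Real.exp (-b * y ^ 2)) y := by
    intro y hy
    rw [hf y hy, Complex.finrank_real_complex]
    by_cases h : y ∈ Set.Ioi a <;> simp [h]
  have hI : Integrable (fun z : ℂ => f ‖z‖) := by
    rw [integrable_fun_norm_addHaar]
    rw [integrableOn_congr_fun hfun measurableSet_Ioi]
    exact (hint.indicator measurableSet_Ioi).integrableOn
  rw [← ofReal_integral_eq_lintegral_ofReal hI (Filter.Eventually.of_forall fun z => hf0 _)]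
  congr 1
  rw [integral_fun_norm_addHaar, setIntegral_congr_fun measurableSet_Ioi hfun,
    setIntegral_indicator measurableSet_Ioi]
  have hset : Set.Ioi (0 : ℝ) ∩ Set.Ioi a = Set.Ioi a := by
    rw [Set.Ioi_inter_Ioi]; simp [ha]
  rw [hset]
  have hval : ∫ y in Set.Ioi a, y * Real.exp (-b * y ^ 2)
      = 0 - (-(1 / (2 * b)) * Real.exp (-b * a ^ 2)) := by
    apply integral_Ioi_of_hasDerivAt_of_tendsto (f := fun y => -(1 / (2 * b)) * Real.exp (-b * y ^ 2))
    · fun_prop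
    · intro x _
      have h1 : HasDerivAt (fun y : ℝ => -b * y ^ 2) (-b * (2 * x)) x := by
        simpa using (hasDerivAt_pow 2 x).const_mul (-b)
      have := (h1.exp).const_mul (-(1 / (2 * b)))
      refine this.congr_deriv ?_
      field_simp
    · exact hint.integrableOn
    · have : Filter.Tendsto (fun y : ℝ => Real.exp (-b * y ^ 2)) Filter.atTop (nhds 0) := by
        apply Real.tendsto_exp_atBot.comp
        apply Filter.Tendsto.const_mul_atTop_of_neg (by linarith)
        exact Filter.tendsto_pow_atTop two_ne_zero
      simpa using this.const_mul (-(1 / (2 * b)))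
  rw [hval, Complex.finrank_real_complex]
  simp only [Measure.real, Complex.volume_ball]
  simp
  field_simp

/-- rotation of `ℂ²` -/
noncomputable def rotL (a b : ℂ) : ℂ × ℂ →ₗ[ℝ] ℂ × ℂ where
  toFun x := (x.1 * a + x.2 * b, - x.1 * star b + x.2 * star a)
  map_add' x y := by ext1 <;> simp <;> ring
  map_smul' c x := by ext1 <;> simp <;> ring

lemma nsq (z : ℂ) : ((‖z‖ ^ 2 : ℝ) : ℂ) = z * star z := by
  rw [← Complex.normSq_eq_norm_sq, ← Complex.mul_conj]; rfl

lemma quat_norm (a b x y : ℂ) :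
    ‖x * a + y * b‖ ^ 2 + ‖- x * star b + y * star a‖ ^ 2
      = (‖a‖ ^ 2 + ‖b‖ ^ 2) * (‖x‖ ^ 2 + ‖y‖ ^ 2) := by
  apply Complex.ofReal_injective
  rw [Complex.ofReal_add, Complex.ofReal_mul, Complex.ofReal_add, Complex.ofReal_add]
  simp only [nsq, star_add, star_mul', star_neg, star_star]
  ring

lemma rotL_mp (a b : ℂ) (h : ‖a‖ ^ 2 + ‖b‖ ^ 2 = 1) :
    MeasurePreserving (rotL a b) (volume : Measure (ℂ × ℂ)) volume := by
  have hinv : ∀ x, ‖(rotL a b x).1‖ ^ 2 + ‖(rotL a b x).2‖ ^ 2 = ‖x.1‖ ^ 2 + ‖x.2‖ ^ 2 := by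
    intro x
    have := quat_norm a b x.1 x.2
    rw [h, one_mul] at this
    exact this
  have hcont : Continuous (rotL a b) := LinearMap.continuous_of_finiteDimensional _
  have hinj : Function.Injective (rotL a b) := by
    rw [injective_iff_map_eq_zero]
    intro x hx
    have := hinv x
    rw [hx] at this
    simp only [Prod.fst_zero, Prod.snd_zero, norm_zero] at this
    have h1 : ‖x.1‖ = 0 := by nlinarith [sq_nonneg ‖x.1‖, sq_nonneg ‖x.2‖]
    have h2 : ‖x.2‖ = 0 := by nlinarith [sq_nonneg ‖x.1‖, sq_nonneg ‖x.2‖]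
    exact Prod.ext (norm_eq_zero.1 h1) (norm_eq_zero.1 h2)
  have hdet : LinearMap.det (rotL a b) ≠ 0 := by
    have := LinearEquiv.isUnit_det' (LinearEquiv.ofInjectiveEndo (rotL a b) hinj)
    exact this.ne_zero
  have hHaar : (volume : Measure (ℂ × ℂ)).IsAddHaarMeasure := by
    rw [Measure.volume_eq_prod]; infer_instance
  have hpre := Measure.addHaar_preimage_linearMap (volume : Measure (ℂ × ℂ)) hdet
  set B : Set (ℂ × ℂ) := {x | ‖x.1‖ ^ 2 + ‖x.2‖ ^ 2 < 1} with hB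
  have hBo : IsOpen B := isOpen_lt (by fun_prop) (by fun_prop)
  have hBpos : volume B ≠ 0 := (hBo.measure_pos volume ⟨0, by simp [hB]⟩).ne'
  have hBfin : volume B ≠ ⊤ := by
    have : B ⊆ Metric.closedBall 0 1 := by
      intro x hx
      have hx' : ‖x.1‖ ^ 2 + ‖x.2‖ ^ 2 < 1 := hx
      rw [mem_closedBall_zero_iff, Prod.norm_def]
      apply max_le <;> nlinarith [norm_nonneg x.1, norm_nonneg x.2]
    exact ((measure_mono this).trans_lt measure_closedBall_lt_top).ne
  have hBB : rotL a b ⁻¹' B = B := by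
    ext x; simp only [hB, Set.mem_preimage, Set.mem_ofPred_eq, hinv]
  have hc : ENNReal.ofReal |(LinearMap.det (rotL a b))⁻¹| = 1 := by
    have := hpre B
    rw [hBB] at this
    have h2 : 1 * volume B = ENNReal.ofReal |(LinearMap.det (rotL a b))⁻¹| * volume B := by
      rw [one_mul]; exact this
    exact ((ENNReal.mul_left_inj hBpos hBfin).1 h2).symm
  refine ⟨hcont.measurable, ?_⟩
  ext s hs
  rw [Measure.map_apply hcont.measurable hs, hpre, hc, one_mul]

noncomputable def gG (x : ℂ × ℂ) : ENNReal := ENNReal.ofReal (Real.exp (-1 * (‖x.1‖ ^ 2 + ‖x.2‖ ^ 2)))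

lemma gG_meas : Measurable gG := by unfold gG; fun_prop

def sS (s : ℝ) : Set (ℂ × ℂ) := {x | ‖x.1‖ ^ 2 < s * (‖x.1‖ ^ 2 + ‖x.2‖ ^ 2)}

lemma sS_meas (s : ℝ) : MeasurableSet (sS s) := by
  apply measurableSet_lt <;> fun_prop

lemma full (b : ℝ) (hb : 0 < b) :
    ∫⁻ z : ℂ, ENNReal.ofReal (Real.exp (-b * ‖z‖ ^ 2)) = ENNReal.ofReal (Real.pi / b) := by
  have := radial_tail b 0 hb le_rfl (fun y => Real.exp (-b * y ^ 2)) (fun y => (Real.exp_pos _).le)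
    (fun y hy => by simp [hy])
  simpa using this

lemma gG_total : ∫⁻ x, gG x = ENNReal.ofReal (Real.pi ^ 2) := by
  have h1 : ∀ x : ℂ × ℂ, gG x = ENNReal.ofReal (Real.exp (-1 * ‖x.1‖ ^ 2)) *
      ENNReal.ofReal (Real.exp (-1 * ‖x.2‖ ^ 2)) := by
    intro x
    rw [← ENNReal.ofReal_mul (Real.exp_pos _).le, ← Real.exp_add, gG, mul_add]
  simp_rw [h1]
  rw [Measure.volume_eq_prod, lintegral_prod_mul
      (f := fun z : ℂ => ENNReal.ofReal (Real.exp (-1 * ‖z‖ ^ 2)))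
      (g := fun z : ℂ => ENNReal.ofReal (Real.exp (-1 * ‖z‖ ^ 2))) (by fun_prop) (by fun_prop), full 1 one_pos,
    ← ENNReal.ofReal_mul (by positivity)]
  simp [sq]

lemma gG_part (s : ℝ) (hs : 0 < s) (hs1 : s ≤ 1) :
    ∫⁻ x, (sS s).indicator gG x = ENNReal.ofReal (Real.pi ^ 2 * s) := by
  set c := (1 - s) / s with hc
  have hc0 : 0 ≤ c := div_nonneg (by linarith) hs.le
  rw [Measure.volume_eq_prod, lintegral_prod _ ((gG_meas.indicator (sS_meas s)).aemeasurable)]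
  have inner : ∀ z : ℂ, ∫⁻ w : ℂ, (sS s).indicator gG (z, w)
      = ENNReal.ofReal Real.pi * ENNReal.ofReal (Real.exp (-(1 + c) * ‖z‖ ^ 2)) := by
    intro z
    have h1 : ∀ w : ℂ, (sS s).indicator gG (z, w) = ENNReal.ofReal (Real.exp (-1 * ‖z‖ ^ 2)) *
        ENNReal.ofReal ((Set.Ioi (√c * ‖z‖)).indicator (fun y => Real.exp (-1 * y ^ 2)) ‖w‖) := by
      intro w
      have key : (z, w) ∈ sS s ↔ ‖w‖ ∈ Set.Ioi (√c * ‖z‖) := by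
        rw [Set.mem_Ioi, ← pow_lt_pow_iff_left₀ (by positivity) (by positivity) two_ne_zero,
          mul_pow, Real.sq_sqrt hc0, hc, div_mul_eq_mul_div, div_lt_iff₀ hs]
        simp only [sS, Set.mem_ofPred_eq]
        constructor <;> intro h <;> linarith
      by_cases h : (z, w) ∈ sS s
      · rw [Set.indicator_of_mem h, Set.indicator_of_mem (key.1 h),
          ← ENNReal.ofReal_mul (Real.exp_pos _).le, ← Real.exp_add, gG, mul_add]
      · rw [Set.indicator_of_notMem h, Set.indicator_of_notMem (fun h' => h (key.2 h'))]
        simp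
    simp_rw [h1]
    rw [lintegral_const_mul' _ _ ENNReal.ofReal_ne_top, radial_tail 1 (√c * ‖z‖) one_pos (by positivity) _
      (fun y => Set.indicator_nonneg (fun _ _ => (Real.exp_pos _).le) _) (fun y _ => rfl),
      ← ENNReal.ofReal_mul (by positivity), ← ENNReal.ofReal_mul (by positivity)]
    congr 1
    rw [mul_pow, Real.sq_sqrt hc0, div_one, mul_left_comm, ← Real.exp_add]
    congr 2
    ring
  simp_rw [inner]
  rw [lintegral_const_mul' _ _ ENNReal.ofReal_ne_top, full _ (by linarith),
    ← ENNReal.ofReal_mul (by positivity)]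
  congr 1
  rw [hc]
  field_simp
  ring

instance : BorelSpace (Matrix.unitaryGroup (Fin 2) ℂ) := ⟨rfl⟩

lemma entry_meas (i j : Fin 2) :
    Measurable (fun U : Matrix.unitaryGroup (Fin 2) ℂ => U.val i j) :=
  (Continuous.matrix_elem continuous_subtype_val i j).measurable

lemma col_norm (U : Matrix.unitaryGroup (Fin 2) ℂ) (j : Fin 2) :
    ‖U.val 0 j‖ ^ 2 + ‖U.val 1 j‖ ^ 2 = 1 := by
  have h := congrFun (congrFun (Matrix.mem_unitaryGroup_iff'.1 U.2) j) j
  apply Complex.ofReal_injective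
  rw [Complex.ofReal_add, nsq, nsq]
  simp [Matrix.mul_apply, Fin.sum_univ_two, Matrix.star_apply] at h
  simp only [Complex.ofReal_one, ← h, RCLike.star_def]
  ring

lemma row_norm (U : Matrix.unitaryGroup (Fin 2) ℂ) (i : Fin 2) :
    ‖U.val i 0‖ ^ 2 + ‖U.val i 1‖ ^ 2 = 1 := by
  have h := congrFun (congrFun (Matrix.mem_unitaryGroup_iff.1 U.2) i) i
  apply Complex.ofReal_injective
  rw [Complex.ofReal_add, nsq, nsq]
  simp [Matrix.mul_apply, Fin.sum_univ_two, Matrix.star_apply] at h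
  simp only [Complex.ofReal_one, ← h, RCLike.star_def]

lemma quat_mem (a b : ℂ) (h : ‖a‖ ^ 2 + ‖b‖ ^ 2 = 1) :
    !![a, b; -star b, star a] ∈ Matrix.unitaryGroup (Fin 2) ℂ := by
  have h' : a * star a + b * star b = 1 := by
    rw [← nsq, ← nsq, ← Complex.ofReal_add, h, Complex.ofReal_one]
  rw [Matrix.mem_unitaryGroup_iff]
  ext i j
  fin_cases i <;> fin_cases j <;>
    simp [Matrix.mul_apply, Fin.sum_univ_two, Matrix.star_apply] <;>
    simp only [RCLike.star_def] at h' <;> first | linear_combination h' | ring1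

lemma haar_entry (μ : Measure (Matrix.unitaryGroup (Fin 2) ℂ)) [IsProbabilityMeasure μ]
    [μ.IsMulLeftInvariant] (j : Fin 2) (s : ℝ) (hs : 0 ≤ s) (hs1 : s ≤ 1) :
    μ {U | ‖U.val 0 j‖ ^ 2 < s} = ENNReal.ofReal s := by
  rcases hs.eq_or_lt with rfl | hs
  · have : {U : Matrix.unitaryGroup (Fin 2) ℂ | ‖U.val 0 j‖ ^ 2 < 0} = ∅ := by
      ext U; simp
    rw [this]; simp
  set p := μ {U | ‖U.val 0 j‖ ^ 2 < s} with hp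
  let T : Set ((ℂ × ℂ) × Matrix.unitaryGroup (Fin 2) ℂ) :=
    {q | ‖q.1.1 * q.2.val 0 j + q.1.2 * q.2.val 1 j‖ ^ 2 < s * (‖q.1.1‖ ^ 2 + ‖q.1.2‖ ^ 2)}
  have e0 : Measurable (fun q : (ℂ × ℂ) × Matrix.unitaryGroup (Fin 2) ℂ => q.2.val 0 j) :=
    (entry_meas 0 j).comp measurable_snd
  have e1 : Measurable (fun q : (ℂ × ℂ) × Matrix.unitaryGroup (Fin 2) ℂ => q.2.val 1 j) :=
    (entry_meas 1 j).comp measurable_snd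
  have hT : MeasurableSet T := by
    apply measurableSet_lt
    · exact ((((measurable_fst.comp measurable_fst).mul e0).add
        ((measurable_snd.comp measurable_fst).mul e1)).norm).pow_const 2
    · fun_prop
  let F : ℂ × ℂ → Matrix.unitaryGroup (Fin 2) ℂ → ENNReal :=
    fun x U => T.indicator (fun q => gG q.1) (x, U)
  have hF : AEMeasurable (Function.uncurry F) ((volume : Measure (ℂ × ℂ)).prod μ) :=
    ((gG_meas.comp measurable_fst).indicator hT).aemeasurable
  have hswap := lintegral_lintegral_swap hF
  have hR : ∀ U, ∫⁻ x, F x U = ENNReal.ofReal (Real.pi ^ 2 * s) := by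
    intro U
    have hcn := col_norm U j
    have hmp := rotL_mp _ _ hcn
    rw [← gG_part s hs hs1, ← hmp.lintegral_comp (gG_meas.indicator (sS_meas s))]
    apply lintegral_congr
    intro x
    have hq := quat_norm (U.val 0 j) (U.val 1 j) x.1 x.2
    rw [hcn, one_mul] at hq
    have hg : gG (rotL (U.val 0 j) (U.val 1 j) x) = gG x := by
      simp only [gG]; rw [← hq]; rfl
    have hm : rotL (U.val 0 j) (U.val 1 j) x ∈ sS s ↔ (x, U) ∈ T := by
      simp only [sS, T, Set.mem_ofPred_eq]; rw [← hq]; rfl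
    by_cases h : (x, U) ∈ T
    · simp only [F]; rw [Set.indicator_of_mem h, Set.indicator_of_mem (hm.2 h), hg]
    · simp only [F]
      rw [Set.indicator_of_notMem h, Set.indicator_of_notMem (fun h' => h (hm.1 h'))]
  have hL : ∀ x : ℂ × ℂ, x ≠ 0 → ∫⁻ U, F x U ∂μ = gG x * p := by
    intro x hx
    set N := ‖x.1‖ ^ 2 + ‖x.2‖ ^ 2 with hN
    have hNpos : 0 < N := by
      rcases (add_nonneg (sq_nonneg ‖x.1‖) (sq_nonneg ‖x.2‖)).lt_or_eq with h | h
      · exact h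
      · exfalso; apply hx
        have h1 : ‖x.1‖ = 0 := by nlinarith [sq_nonneg ‖x.1‖, sq_nonneg ‖x.2‖]
        have h2 : ‖x.2‖ = 0 := by nlinarith [sq_nonneg ‖x.1‖, sq_nonneg ‖x.2‖]
        exact Prod.ext (norm_eq_zero.1 h1) (norm_eq_zero.1 h2)
    set r : ℂ := (((√N)⁻¹ : ℝ) : ℂ) with hr
    have hrn : ‖r‖ ^ 2 = N⁻¹ := by
      rw [hr, Complex.norm_real, Real.norm_eq_abs, sq_abs, inv_pow, Real.sq_sqrt hNpos.le]
    have hV : ‖r * x.1‖ ^ 2 + ‖r * x.2‖ ^ 2 = 1 := by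
      rw [norm_mul, norm_mul, mul_pow, mul_pow, ← mul_add, hrn, ← hN, inv_mul_cancel₀ hNpos.ne']
    let V : Matrix.unitaryGroup (Fin 2) ℂ := ⟨_, quat_mem _ _ hV⟩
    have hpre := measure_preimage_mul μ V {U | ‖U.val 0 j‖ ^ 2 < s}
    have hset : (fun U => V * U) ⁻¹' {U | ‖U.val 0 j‖ ^ 2 < s} = {U | (x, U) ∈ T} := by
      ext U
      have h1 : (V * U).val 0 j = r * (x.1 * U.val 0 j + x.2 * U.val 1 j) := by
        simp [V, Matrix.mul_apply, Fin.sum_univ_two]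
        ring
      simp only [Set.mem_preimage, Set.mem_ofPred_eq, T]
      rw [h1, norm_mul, mul_pow, hrn, inv_mul_eq_div, div_lt_iff₀ hNpos]
    have hTm : MeasurableSet {U | (x, U) ∈ T} := measurable_prodMk_left hT
    have : ∀ U, F x U = {U | (x, U) ∈ T}.indicator (fun _ => gG x) U := by
      intro U
      simp only [F, Set.indicator, Set.mem_ofPred_eq]
    simp_rw [this]
    rw [lintegral_indicator_const hTm, ← hset, hpre]
  have hae : ∀ᵐ x : ℂ × ℂ, ∫⁻ U, F x U ∂μ = gG x * p := by
    have : ∀ᵐ x : ℂ × ℂ, x ≠ 0 := by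
      have h0 : (volume : Measure (ℂ × ℂ)) {0} = 0 := by
        rw [Measure.volume_eq_prod, ← Prod.mk_zero_zero, ← Set.singleton_prod_singleton,
          Measure.prod_prod]
        simp
      exact compl_mem_ae_iff.2 h0
    filter_upwards [this] with x hx using hL x hx
  rw [lintegral_congr_ae hae, lintegral_congr hR, lintegral_mul_const _ gG_meas, gG_total,
    lintegral_const, measure_univ, mul_one, ENNReal.ofReal_mul (by positivity)] at hswap
  exact (ENNReal.mul_right_inj (by simp) ENNReal.ofReal_ne_top).1 hswap

theorem haar_ML_outage_exact (C ρ₁ ρ₂ R : ℝ) (hC : 0 < C) (hρ₂ : 0 ≤ ρ₂)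
    (hρ : ρ₂ ≤ ρ₁) (hprod : (1 + ρ₁) * (1 + ρ₂) = (2 : ℝ) ^ C) (hlt : ρ₂ < ρ₁)
    (hRlb : 2 * Real.logb 2 (1 + ρ₂) ≤ R) (hRC : R ≤ C)
    (μ : Measure (Matrix.unitaryGroup (Fin 2) ℂ)) [IsProbabilityMeasure μ]
    [μ.IsMulLeftInvariant] :
    (μ {U : Matrix.unitaryGroup (Fin 2) ℂ |
        min (min
            (2 * Real.logb 2 (1 + ρ₁ * ‖U.val 0 0‖ ^ 2 + ρ₂ * ‖U.val 1 0‖ ^ 2))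
            (2 * Real.logb 2 (1 + ρ₁ * ‖U.val 0 1‖ ^ 2 + ρ₂ * ‖U.val 1 1‖ ^ 2)))
          C < R}).toReal =
      2 * ((2 : ℝ) ^ (R / 2) - 1 - ρ₂) / ((2 : ℝ) ^ C / (1 + ρ₂) - 1 - ρ₂) := by
  have hd : (2 : ℝ) ^ C / (1 + ρ₂) - 1 - ρ₂ = ρ₁ - ρ₂ := by
    rw [← hprod, mul_div_assoc, div_self (by linarith)]; ring
  have hD : 0 < ρ₁ - ρ₂ := by linarith
  rw [hd]
  set q := (2 : ℝ) ^ (R / 2) with hq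
  have hqpos : 0 < q := by positivity
  have hq1 : 1 + ρ₂ ≤ q := by
    rw [hq, ← Real.logb_le_iff_le_rpow (by norm_num) (by linarith)]; linarith
  have hq2 : q ^ 2 ≤ (1 + ρ₁) * (1 + ρ₂) := by
    rw [hprod, hq, ← Real.rpow_natCast, ← Real.rpow_mul (by norm_num)]
    apply Real.rpow_le_rpow_of_exponent_le (by norm_num)
    push_cast; linarith
  set s := (q - 1 - ρ₂) / (ρ₁ - ρ₂) with hs
  have hs0 : 0 ≤ s := div_nonneg (by linarith) hD.le
  have hs2 : s ≤ 1 / 2 := by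
    rw [hs, div_le_iff₀ hD]
    nlinarith [sq_nonneg (ρ₁ - ρ₂)]
  have hev : ∀ (U : Matrix.unitaryGroup (Fin 2) ℂ) (j : Fin 2),
      2 * Real.logb 2 (1 + ρ₁ * ‖U.val 0 j‖ ^ 2 + ρ₂ * ‖U.val 1 j‖ ^ 2) < R ↔
        ‖U.val 0 j‖ ^ 2 < s := by
    intro U j
    have hc := col_norm U j
    have hpos : 0 < 1 + ρ₁ * ‖U.val 0 j‖ ^ 2 + ρ₂ * ‖U.val 1 j‖ ^ 2 := by
      have : 0 ≤ ρ₁ := by linarith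
      positivity
    rw [hs, lt_div_iff₀ hD, ← lt_div_iff₀' (by norm_num : (0 : ℝ) < 2),
      Real.logb_lt_iff_lt_rpow (by norm_num) hpos, ← hq]
    have : ‖U.val 1 j‖ ^ 2 = 1 - ‖U.val 0 j‖ ^ 2 := by linarith
    rw [this]
    constructor <;> intro h <;> linarith
  have hset : {U : Matrix.unitaryGroup (Fin 2) ℂ |
        min (min
            (2 * Real.logb 2 (1 + ρ₁ * ‖U.val 0 0‖ ^ 2 + ρ₂ * ‖U.val 1 0‖ ^ 2))
            (2 * Real.logb 2 (1 + ρ₁ * ‖U.val 0 1‖ ^ 2 + ρ₂ * ‖U.val 1 1‖ ^ 2)))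
          C < R} = {U | ‖U.val 0 0‖ ^ 2 < s} ∪ {U | ‖U.val 0 1‖ ^ 2 < s} := by
    ext U
    simp only [Set.mem_ofPred_eq, Set.mem_union, min_lt_iff, hev, not_lt.2 hRC, or_false]
  have hdisj : Disjoint {U : Matrix.unitaryGroup (Fin 2) ℂ | ‖U.val 0 0‖ ^ 2 < s}
      {U | ‖U.val 0 1‖ ^ 2 < s} := by
    rw [Set.disjoint_left]
    intro U h0 h1
    simp only [Set.mem_ofPred_eq] at h0 h1
    linarith [row_norm U 0]
  have hm : MeasurableSet {U : Matrix.unitaryGroup (Fin 2) ℂ | ‖U.val 0 1‖ ^ 2 < s} :=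
    measurableSet_lt ((entry_meas 0 1).norm.pow_const 2) measurable_const
  rw [hset, measure_union hdisj hm, haar_entry μ 0 s hs0 (by linarith),
    haar_entry μ 1 s hs0 (by linarith), ← ENNReal.ofReal_add hs0 hs0,
    ENNReal.toReal_ofReal (by linarith), hs]
  ring
end
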